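/- arXiv:1810.04298 — 2 statements merged into one kernel-verified Lean document; each statement's English description precedes it below -/
import Mathlib

section
/- There exists a universal constant C < ∞ such that for all η ∈ (0,1], b > 1 and ε ∈ (0,1) there exists c > 0 with the following property. Let X_0, X_1, … be a martingale with values in (0,1], X_0 ∈ (0,1), such that for every t, almost surely ℙ[X_{t+1} < X_t^b | X_0,…,X_t] ≥ η. Then for every T ≥ 1, ℙ[log X_T > (log X_0 + C·T)·b^{(1-ε)·η·T}] < exp(-c·ε·η·T). -/
open MeasureTheory

/- The σ-algebra generated by `X_0, …, X_t`. -/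
def pastSigma {Ω : Type} (X : ℕ → Ω → ℝ) (t : ℕ) : MeasurableSpace Ω :=
  MeasurableSpace.comap (fun ω (i : Fin (t + 1)) => X i ω) inferInstance

open scoped ENNReal

lemma pastSigma_le {Ω : Type} {m : MeasurableSpace Ω} {X : ℕ → Ω → ℝ} {t : ℕ}
    (h : ∀ i ≤ t, Measurable[m] (X i)) : pastSigma X t ≤ m :=
  Measurable.comap_le (measurable_pi_lambda _ fun i => h i (Nat.lt_succ_iff.mp i.2))

lemma measurable_pastSigma {Ω : Type} (X : ℕ → Ω → ℝ) {i t : ℕ} (h : i ≤ t) :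
    Measurable[pastSigma X t] (X i) :=
  (measurable_pi_apply (⟨i, Nat.lt_succ_iff.mpr h⟩ : Fin (t + 1))).comp
    (comap_measurable fun ω (i : Fin (t + 1)) => X i ω)

lemma pastSigma_mono {Ω : Type} (X : ℕ → Ω → ℝ) : Monotone (pastSigma X) :=
  fun _ _ hst => pastSigma_le fun _ hi => measurable_pastSigma X (hi.trans hst)

lemma lintegral_mul_le_of_condExp_le {Ω : Type*} {m mΩ : MeasurableSpace Ω} {μ : Measure Ω}
    [IsFiniteMeasure μ] (hm : m ≤ mΩ) {f g : Ω → ℝ} (hf : Measurable f) (hg : Measurable g)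
    (hfi : Integrable f μ) (hgi : Integrable g μ) (hf0 : 0 ≤ᵐ[μ] f) (hg0 : 0 ≤ᵐ[μ] g)
    (hle : μ[f | m] ≤ᵐ[μ] μ[g | m]) {A : Ω → ℝ≥0∞} (hA : Measurable[m] A) :
    ∫⁻ ω, A ω * ENNReal.ofReal (f ω) ∂μ ≤ ∫⁻ ω, A ω * ENNReal.ofReal (g ω) ∂μ := by
  have key : ∀ {h : Ω → ℝ}, Measurable h → ∫⁻ ω, A ω * ENNReal.ofReal (h ω) ∂μ =
      ∫⁻ ω, A ω ∂((μ.withDensity fun ω => ENNReal.ofReal (h ω)).trim hm) := by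
    intro h hh
    rw [lintegral_trim hm hA,
      lintegral_withDensity_eq_lintegral_mul _ hh.ennreal_ofReal (hA.mono hm le_rfl)]
    simp only [Pi.mul_apply, mul_comm]
  rw [key hf, key hg]
  refine lintegral_mono' ?_ le_rfl
  refine Measure.le_iff.mpr fun s hs => ?_
  rw [trim_measurableSet_eq hm hs, trim_measurableSet_eq hm hs,
    withDensity_apply _ (hm s hs), withDensity_apply _ (hm s hs),
    ← ofReal_integral_eq_lintegral_ofReal hfi.integrableOn (ae_restrict_of_ae hf0),
    ← ofReal_integral_eq_lintegral_ofReal hgi.integrableOn (ae_restrict_of_ae hg0),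
    ← setIntegral_condExp hm hfi hs, ← setIntegral_condExp hm hgi hs]
  exact ENNReal.ofReal_le_ofReal
    (setIntegral_mono_ae integrable_condExp.integrableOn integrable_condExp.integrableOn hle)

lemma measurable_prod_range {Ω : Type*} {ℱ : ℕ → MeasurableSpace Ω} (hℱ : Monotone ℱ)
    {Z : ℕ → Ω → ℝ≥0∞} (hZ : ∀ t, Measurable[ℱ (t + 1)] (Z t)) (n : ℕ) :
    Measurable[ℱ n] fun ω => ∏ t ∈ Finset.range n, Z t ω :=
  Finset.measurable_fun_prod _ fun t ht =>
    (hZ t).mono (hℱ (Nat.succ_le_of_lt (Finset.mem_range.mp ht))) le_rfl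

lemma lintegral_prod_range_le {Ω : Type*} {mΩ : MeasurableSpace Ω} {μ : Measure Ω}
    [IsProbabilityMeasure μ] {ℱ : ℕ → MeasurableSpace Ω} (hℱ : Monotone ℱ)
    {Z : ℕ → Ω → ℝ≥0∞} (hZ : ∀ t, Measurable[ℱ (t + 1)] (Z t)) {k : ℝ≥0∞}
    (hk : ∀ t, ∀ A : Ω → ℝ≥0∞, Measurable[ℱ t] A →
      ∫⁻ ω, A ω * Z t ω ∂μ ≤ (∫⁻ ω, A ω ∂μ) * k) (n : ℕ) :
    ∫⁻ ω, ∏ t ∈ Finset.range n, Z t ω ∂μ ≤ k ^ n := by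
  induction n with
  | zero => simp
  | succ n ih =>
    simp only [Finset.prod_range_succ, pow_succ]
    exact (hk n _ (measurable_prod_range hℱ hZ n)).trans (by gcongr)

lemma le_lintegral_prod_range {Ω : Type*} {mΩ : MeasurableSpace Ω} {μ : Measure Ω}
    [IsProbabilityMeasure μ] {ℱ : ℕ → MeasurableSpace Ω} (hℱ : Monotone ℱ)
    {Z : ℕ → Ω → ℝ≥0∞} (hZ : ∀ t, Measurable[ℱ (t + 1)] (Z t)) {k : ℝ≥0∞}
    (hk : ∀ t, ∀ A : Ω → ℝ≥0∞, Measurable[ℱ t] A →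
      (∫⁻ ω, A ω ∂μ) * k ≤ ∫⁻ ω, A ω * Z t ω ∂μ) (n : ℕ) :
    k ^ n ≤ ∫⁻ ω, ∏ t ∈ Finset.range n, Z t ω ∂μ := by
  induction n with
  | zero => simp
  | succ n ih =>
    simp only [Finset.prod_range_succ, pow_succ]
    exact le_trans (by gcongr) (hk n _ (measurable_prod_range hℱ hZ n))

open Classical in
/-- Multiplying by `b` at the times in `J` and losing at most the positive increments otherwise
turns `-y 0` into at least `b ^ #J` times `-y 0` minus the total loss. -/
lemma le_pow_card_mul_of_jumps {b : ℝ} (hb : 1 ≤ b) {y : ℕ → ℝ} {J : ℕ → Prop}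
    (hJ : ∀ t, J t → y (t + 1) ≤ b * y t) (n : ℕ) :
    y n ≤ b ^ ((Finset.range n).filter J).card *
      (y 0 + ∑ t ∈ Finset.range n, max (y (t + 1) - y t) 0) := by
  induction n with
  | zero => simp
  | succ n ih =>
    rw [Finset.sum_range_succ, Finset.range_add_one, Finset.filter_insert]
    set N := ((Finset.range n).filter J).card
    set s := ∑ t ∈ Finset.range n, max (y (t + 1) - y t) 0
    have h1 : 1 ≤ b ^ N := one_le_pow₀ hb
    have h0 : 0 ≤ max (y (n + 1) - y n) 0 := le_max_right _ _
    have h2 : y (n + 1) - y n ≤ max (y (n + 1) - y n) 0 := le_max_left _ _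
    split_ifs with h
    · rw [Finset.card_insert_of_notMem (by simp)]
      calc y (n + 1) ≤ b * y n := hJ n h
        _ ≤ b * (b ^ N * (y 0 + s)) := by gcongr
        _ = b ^ (N + 1) * (y 0 + s) := by ring
        _ ≤ _ := by gcongr; linarith
    · nlinarith

open Classical in
/-- The log-values of a path lie below the claimed threshold as soon as there are many jumps and
the total upward movement is small. -/
lemma log_le_of_jumps {x : ℕ → ℝ} (hx : ∀ t, x t ∈ Set.Ioc (0 : ℝ) 1) (hb : 1 < b) {T : ℕ}
    {r s : ℝ} (hr : r ≤ ((Finset.range T).filter fun t => x (t + 1) < x t ^ b).card)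
    (hs : ∑ t ∈ Finset.range T, max (Real.log (x (t + 1)) - Real.log (x t)) 0 ≤ s) :
    Real.log (x T) ≤ (Real.log (x 0) + s) * b ^ r := by
  have hlog : Real.log (x T) ≤ 0 := Real.log_nonpos (hx T).1.le (hx T).2
  have hb0 : 0 < b := by linarith
  rcases le_total 0 (Real.log (x 0) + s) with h | h
  · exact hlog.trans (by positivity)
  have hmain := le_pow_card_mul_of_jumps hb.le (y := fun t => Real.log (x t))
    (J := fun t => x (t + 1) < x t ^ b) (fun t ht => by
      rw [← Real.log_rpow (hx t).1]
      exact Real.log_le_log (hx (t + 1)).1 ht.le) T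
  have hpow : b ^ r ≤ b ^ ((Finset.range T).filter fun t => x (t + 1) < x t ^ b).card := by
    rw [← Real.rpow_natCast]
    exact Real.rpow_le_rpow_of_exponent_le hb.le hr
  calc Real.log (x T) ≤ _ := hmain
    _ ≤ b ^ ((Finset.range T).filter fun t => x (t + 1) < x t ^ b).card *
        (Real.log (x 0) + s) := by gcongr
    _ ≤ b ^ r * (Real.log (x 0) + s) := mul_le_mul_of_nonpos_right hpow h
    _ = _ := mul_comm _ _

/-- The exponential rate in the lower tail bound for the number of jumps. -/
lemma one_sub_mul_le_exp {η ε : ℝ} (hη : 0 < η) (hε : 0 < ε) (hε1 : ε < 1) :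
    1 - η * (1 - Real.exp (-ε)) ≤ Real.exp (-(ε * (1 - ε) * η) - η * ε ^ 2 / 2) := by
  have h : Real.exp (-ε) ≤ 1 - ε + ε ^ 2 / 2 := by
    have := Real.quadratic_le_exp_of_nonneg hε.le
    rw [Real.exp_neg, inv_le_iff_one_le_mul₀ (Real.exp_pos _)]
    have h2 : 0 ≤ 1 - ε + ε ^ 2 / 2 := by nlinarith
    nlinarith [mul_le_mul_of_nonneg_left this h2, sq_nonneg (ε ^ 2)]
  have := Real.add_one_le_exp (-(ε * (1 - ε) * η) - η * ε ^ 2 / 2)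
  nlinarith

/-- A tail bound `2 exp (-a T)` together with a bound `1 - η ^ T` gives a pure exponential bound. -/
lemma exists_exp_rate {η ε : ℝ} (hη : 0 < η) (hη1 : η ≤ 1) (hε : 0 < ε) (hε1 : ε < 1) :
    ∃ c : ℝ, 0 < c ∧ ∀ (T : ℕ) (p : ℝ), 1 ≤ T → p ≤ 1 - η ^ T →
      p ≤ 2 * Real.exp (-(η * ε ^ 2 / 2) * T) → p < Real.exp (-(c * ε * η * T)) := by
  have ha : 0 < η * ε ^ 2 / 4 := by positivity
  obtain ⟨n, hn⟩ := exists_nat_gt (1 / (η * ε ^ 2 / 4))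
  rw [div_lt_iff₀ ha] at hn
  have hn0 : (0 : ℝ) < n := by
    by_contra! h
    nlinarith
  refine ⟨min (ε / 8) (η ^ n / n), by positivity, fun T p hT h1 h2 => ?_⟩
  set c := min (ε / 8) (η ^ n / n)
  have hc1 : c ≤ ε / 8 := min_le_left _ _
  have hc2 : c * n ≤ η ^ n := (le_div_iff₀ hn0).mp (min_le_right _ _)
  have hc0 : 0 < c := by positivity
  have hT0 : (1 : ℝ) ≤ T := by exact_mod_cast hT
  rcases le_total T n with h | h
  · have hTn : (T : ℝ) ≤ n := by exact_mod_cast h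
    have hpow : η ^ n ≤ η ^ T := pow_le_pow_of_le_one hη.le hη1 h
    have hεη : ε * η ≤ 1 := by nlinarith
    have : c * ε * η * T ≤ η ^ T := by
      calc c * ε * η * T = (c * T) * (ε * η) := by ring
        _ ≤ c * T * 1 := by gcongr
        _ ≤ c * n * 1 := by gcongr
        _ ≤ η ^ T := by linarith
    have hpos : 0 < η ^ T := by positivity
    calc p ≤ 1 - η ^ T := h1
      _ < Real.exp (-η ^ T) := by
        have := Real.add_one_lt_exp (x := -η ^ T) (by linarith)
        linarith
      _ ≤ _ := Real.exp_le_exp.mpr (by linarith)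
  · have hTn : (n : ℝ) ≤ T := by exact_mod_cast h
    have h3 : 2 ≤ Real.exp (η * ε ^ 2 / 4 * T) := by
      have := Real.add_one_le_exp (η * ε ^ 2 / 4 * T)
      nlinarith
    calc p ≤ 2 * Real.exp (-(η * ε ^ 2 / 2) * T) := h2
      _ ≤ Real.exp (η * ε ^ 2 / 4 * T) * Real.exp (-(η * ε ^ 2 / 2) * T) := by gcongr
      _ = Real.exp (-(η * ε ^ 2 / 4) * T) := by rw [← Real.exp_add]; ring_nf
      _ < _ := by
        rw [Real.exp_lt_exp]
        have : c * (ε * η * T) ≤ ε / 8 * (ε * η * T) := by gcongr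
        have : 0 < η * ε ^ 2 * T := by positivity
        nlinarith

/-- The event that `X` jumps below its `b`-th power at time `t + 1`. -/
def jumpSet {Ω : Type} (X : ℕ → Ω → ℝ) (b : ℝ) (t : ℕ) : Set Ω := {ω | X (t + 1) ω < X t ω ^ b}

lemma measurableSet_jumpSet {Ω : Type} {m : MeasurableSpace Ω} {X : ℕ → Ω → ℝ} {b : ℝ} {t : ℕ}
    (h : Measurable[m] (X t)) (h' : Measurable[m] (X (t + 1))) :
    MeasurableSet[m] (jumpSet X b t) :=
  measurableSet_lt h' (h.pow_const b)

lemma measurableSet_jumpSet_pastSigma {Ω : Type} (X : ℕ → Ω → ℝ) (b : ℝ)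
    (t : ℕ) : MeasurableSet[pastSigma X (t + 1)] (jumpSet X b t) :=
  measurableSet_jumpSet (measurable_pastSigma X t.le_succ) (measurable_pastSigma X le_rfl)

section Jumps

variable {Ω : Type} [MeasurableSpace Ω] {μ : Measure Ω} [IsProbabilityMeasure μ]
  {X : ℕ → Ω → ℝ} {η b : ℝ}

lemma pow_le_measure_jumps (hη : 0 < η) (hX : ∀ t, Measurable (X t))
    (hjump : ∀ t, ∀ᵐ ω ∂μ,
      η ≤ (μ[(jumpSet X b t).indicator fun _ => (1 : ℝ) | pastSigma X t]) ω) (T : ℕ) :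
    ENNReal.ofReal η ^ T ≤ μ (⋂ t ∈ Finset.range T, jumpSet X b t) := by
  have hmeas := fun t => measurableSet_jumpSet (b := b) (hX t) (hX (t + 1))
  have hm : ∀ t, pastSigma X t ≤ ‹MeasurableSpace Ω› := fun t => pastSigma_le fun i _ => hX i
  have h := le_lintegral_prod_range (μ := μ) (pastSigma_mono X)
    (Z := fun t ω => ENNReal.ofReal ((jumpSet X b t).indicator (fun _ => (1 : ℝ)) ω))
    (fun t => ENNReal.measurable_ofReal.comp
      (measurable_const.indicator (measurableSet_jumpSet_pastSigma X b t)))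
    (k := ENNReal.ofReal η) (fun t A hA => by
      rw [← lintegral_mul_const _ (hA.mono (hm t) le_rfl)]
      refine lintegral_mul_le_of_condExp_le (f := fun _ => η) (hm t) measurable_const
        (measurable_const.indicator (hmeas t)) (integrable_const _)
        ((integrable_const _).indicator (hmeas t)) (ae_of_all _ fun _ => hη.le)
        (ae_of_all _ fun ω => Set.indicator_nonneg (fun _ _ => zero_le_one) ω) ?_ hA
      rw [condExp_const (hm t)]
      exact hjump t) T
  refine h.trans ?_
  rw [← lintegral_indicator_one
    (Finset.measurableSet_biInter _ fun t _ => hmeas t)]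
  refine lintegral_mono fun ω => ?_
  by_cases hω : ω ∈ ⋂ t ∈ Finset.range T, jumpSet X b t
  · rw [Set.indicator_of_mem hω]
    refine Finset.prod_le_one' fun t _ => ?_
    rw [ENNReal.ofReal_le_one]
    exact Set.indicator_le_self' (fun _ _ => zero_le_one) ω
  · simp only [Set.mem_iInter, not_forall] at hω
    obtain ⟨t, ht, hωt⟩ := hω
    rw [Finset.prod_eq_zero ht (by simp [Set.indicator_of_notMem hωt])]
    exact zero_le

open Classical in
lemma measure_card_jumps_lt_le {ε : ℝ} (hη : 0 < η) (hη1 : η ≤ 1) (hε : 0 < ε) (hε1 : ε < 1)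
    (hX : ∀ t, Measurable (X t))
    (hjump : ∀ t, ∀ᵐ ω ∂μ,
      η ≤ (μ[(jumpSet X b t).indicator fun _ => (1 : ℝ) | pastSigma X t]) ω) (T : ℕ) :
    μ {ω | (((Finset.range T).filter fun t => ω ∈ jumpSet X b t).card : ℝ) < (1 - ε) * η * T} ≤
      ENNReal.ofReal (Real.exp (-(η * ε ^ 2 / 2) * T)) := by
  have hmeas := fun t => measurableSet_jumpSet (b := b) (hX t) (hX (t + 1))
  have hm : ∀ t, pastSigma X t ≤ ‹MeasurableSpace Ω› := fun t => pastSigma_le fun i _ => hX i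
  have hexp : Real.exp (-ε) < 1 := by simpa using hε
  have hexp0 := Real.exp_pos (-ε)
  have hind : ∀ t, Integrable ((jumpSet X b t).indicator fun _ => (1 : ℝ)) μ :=
    fun t => (integrable_const _).indicator (hmeas t)
  let f : ℕ → Ω → ℝ := fun t =>
    (fun _ => 1) - (1 - Real.exp (-ε)) • (jumpSet X b t).indicator fun _ => 1
  have hf : ∀ t ω, f t ω = if ω ∈ jumpSet X b t then Real.exp (-ε) else 1 := by
    intro t ω
    by_cases h : ω ∈ jumpSet X b t <;> simp [f, h]
  have hk0 : 0 ≤ 1 - η * (1 - Real.exp (-ε)) := by nlinarith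
  have hfm : ∀ {m : MeasurableSpace Ω} {t}, MeasurableSet[m] (jumpSet X b t) →
      Measurable[m] (f t) := fun h =>
    measurable_const.sub ((measurable_const.indicator h).const_smul _)
  have h := lintegral_prod_range_le (μ := μ) (pastSigma_mono X)
    (Z := fun t ω => ENNReal.ofReal (f t ω))
    (fun t => ENNReal.measurable_ofReal.comp (hfm (measurableSet_jumpSet_pastSigma X b t)))
    (k := ENNReal.ofReal (1 - η * (1 - Real.exp (-ε)))) (fun t A hA => by
      rw [← lintegral_mul_const _ (hA.mono (hm t) le_rfl)]
      refine lintegral_mul_le_of_condExp_le (g := fun _ => 1 - η * (1 - Real.exp (-ε))) (hm t)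
        (hfm (hmeas t)) measurable_const ((integrable_const _).sub ((hind t).smul _))
        (integrable_const _) (ae_of_all _ fun ω => ?_) (ae_of_all _ fun _ => hk0) ?_ hA
      · simp only [hf, Pi.zero_apply]
        split_ifs <;> positivity
      · rw [condExp_const (hm t)]
        filter_upwards [hjump t, condExp_sub (integrable_const (1 : ℝ))
          ((hind t).smul (1 - Real.exp (-ε))) (pastSigma X t),
          condExp_smul (μ := μ) (1 - Real.exp (-ε))
            ((jumpSet X b t).indicator fun _ => (1 : ℝ)) (pastSigma X t)] with ω h1 h2 h3
        rw [h2, Pi.sub_apply, h3, condExp_const (hm t), Pi.smul_apply, smul_eq_mul]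
        nlinarith) T
  have hprod : ∀ ω, ∏ t ∈ Finset.range T, ENNReal.ofReal (f t ω) = ENNReal.ofReal
      (Real.exp (-ε) ^ ((Finset.range T).filter fun t => ω ∈ jumpSet X b t).card) := by
    intro ω
    rw [← ENNReal.ofReal_prod_of_nonneg
      (fun t _ => by rw [hf]; split_ifs <;> positivity)]
    simp [hf, Finset.prod_ite]
  have hsub : {ω | (((Finset.range T).filter fun t => ω ∈ jumpSet X b t).card : ℝ) <
      (1 - ε) * η * T} ⊆ {ω | ENNReal.ofReal (Real.exp (-(ε * ((1 - ε) * η * T)))) ≤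
        ∏ t ∈ Finset.range T, ENNReal.ofReal (f t ω)} := by
    intro ω hω
    simp only [Set.mem_ofPred_eq] at hω ⊢
    rw [hprod, ← Real.exp_nat_mul]
    apply ENNReal.ofReal_le_ofReal
    rw [Real.exp_le_exp]
    nlinarith
  refine (measure_mono hsub).trans ((meas_ge_le_lintegral_div ?_ ?_ ?_).trans ?_)
  · exact (measurable_prod_range (ℱ := fun _ => ‹MeasurableSpace Ω›) monotone_const
      (fun t => ENNReal.measurable_ofReal.comp (hfm (hmeas t))) T).aemeasurable
  · simpa using Real.exp_pos _
  · exact ENNReal.ofReal_ne_top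
  · refine (ENNReal.div_le_div_right h _).trans ?_
    rw [← ENNReal.ofReal_pow hk0, ← ENNReal.ofReal_div_of_pos (Real.exp_pos _)]
    apply ENNReal.ofReal_le_ofReal
    rw [div_le_iff₀ (Real.exp_pos _), ← Real.exp_add]
    refine (pow_le_pow_left₀ hk0 (one_sub_mul_le_exp hη hε hε1) T).trans_eq ?_
    rw [← Real.exp_nat_mul]
    ring_nf

lemma measure_sum_increments_gt_le (hX : ∀ t, Measurable (X t))
    (hmem : ∀ t, ∀ᵐ ω ∂μ, X t ω ∈ Set.Ioc (0 : ℝ) 1)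
    (hmart : ∀ t, μ[X (t + 1) | pastSigma X t] =ᵐ[μ] X t) (T : ℕ) :
    μ {ω | 2 * (T : ℝ) < ∑ t ∈ Finset.range T,
      max (Real.log (X (t + 1) ω) - Real.log (X t ω)) 0} ≤
      ENNReal.ofReal (Real.exp (-T)) := by
  have hm : ∀ t, pastSigma X t ≤ ‹MeasurableSpace Ω› := fun t => pastSigma_le fun i _ => hX i
  have hXi : ∀ t, Integrable (X t) μ := fun t =>
    Integrable.of_bound (hX t).aestronglyMeasurable 1 <| by
      filter_upwards [hmem t] with ω h
      rw [Real.norm_of_nonneg h.1.le]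
      exact h.2
  have hnn : ∀ t, 0 ≤ᵐ[μ] X t := fun t => (hmem t).mono fun ω h => h.1.le
  let f : ℕ → Ω → ℝ := fun t ω =>
    Real.exp (max (Real.log (X (t + 1) ω) - Real.log (X t ω)) 0)
  have hfm : ∀ {m : MeasurableSpace Ω} {t}, Measurable[m] (X t) → Measurable[m] (X (t + 1)) →
      Measurable[m] (f t) := fun h h' =>
    Real.measurable_exp.comp (((Real.measurable_log.comp h').sub
      (Real.measurable_log.comp h)).max measurable_const)
  have h := lintegral_prod_range_le (μ := μ) (pastSigma_mono X)
    (Z := fun t ω => ENNReal.ofReal (f t ω))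
    (fun t => ENNReal.measurable_ofReal.comp
      (hfm (measurable_pastSigma X t.le_succ) (measurable_pastSigma X le_rfl)))
    (k := 2) (fun t A hA => by
      have hXt := measurable_pastSigma X (le_refl t)
      have hA' : Measurable[pastSigma X t] fun ω => A ω * ENNReal.ofReal (X t ω)⁻¹ :=
        hA.mul (ENNReal.measurable_ofReal.comp hXt.inv)
      have hstep := lintegral_mul_le_of_condExp_le (hm t) (hX (t + 1)) (hX t) (hXi _) (hXi _)
        (hnn _) (hnn _) (by
          rw [condExp_of_stronglyMeasurable (hm t) hXt.stronglyMeasurable (hXi t)]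
          exact (hmart t).le) hA'
      calc ∫⁻ ω, A ω * ENNReal.ofReal (f t ω) ∂μ
          ≤ ∫⁻ ω, A ω + A ω * ENNReal.ofReal (X t ω)⁻¹ * ENNReal.ofReal (X (t + 1) ω) ∂μ := by
            refine lintegral_mono_ae ?_
            filter_upwards [hmem t, hmem (t + 1)] with ω h1 h2
            rw [mul_assoc, ← ENNReal.ofReal_mul (inv_nonneg.mpr h1.1.le)]
            nth_rewrite 2 [← mul_one (A ω)]
            rw [← mul_add, ← ENNReal.ofReal_one,
              ← ENNReal.ofReal_add zero_le_one (mul_nonneg (inv_nonneg.mpr h1.1.le) h2.1.le)]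
            gcongr
            have hq : 0 < (X t ω)⁻¹ * X (t + 1) ω := mul_pos (inv_pos.mpr h1.1) h2.1
            simp only [f]
            rcases max_cases (Real.log (X (t + 1) ω) - Real.log (X t ω)) 0 with ⟨h, _⟩ | ⟨h, _⟩
            · rw [h, Real.exp_sub, Real.exp_log h1.1, Real.exp_log h2.1, div_eq_inv_mul]
              linarith
            · rw [h, Real.exp_zero]
              linarith
        _ = ∫⁻ ω, A ω ∂μ +
            ∫⁻ ω, A ω * ENNReal.ofReal (X t ω)⁻¹ * ENNReal.ofReal (X (t + 1) ω) ∂μ :=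
            lintegral_add_left (hA.mono (hm t) le_rfl) _
        _ ≤ ∫⁻ ω, A ω ∂μ +
            ∫⁻ ω, A ω * ENNReal.ofReal (X t ω)⁻¹ * ENNReal.ofReal (X t ω) ∂μ := by gcongr
        _ = ∫⁻ ω, A ω ∂μ + ∫⁻ ω, A ω ∂μ := by
            congr 1
            refine lintegral_congr_ae ?_
            filter_upwards [hmem t] with ω h1
            rw [mul_assoc, ← ENNReal.ofReal_mul (inv_nonneg.mpr h1.1.le),
              inv_mul_cancel₀ h1.1.ne', ENNReal.ofReal_one, mul_one]
        _ = _ := (mul_two _).symm) T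
  have hsub : {ω | 2 * (T : ℝ) < ∑ t ∈ Finset.range T,
      max (Real.log (X (t + 1) ω) - Real.log (X t ω)) 0} ⊆
      {ω | ENNReal.ofReal (Real.exp (2 * T)) ≤
        ∏ t ∈ Finset.range T, ENNReal.ofReal (f t ω)} := by
    intro ω hω
    simp only [Set.mem_ofPred_eq] at hω ⊢
    rw [← ENNReal.ofReal_prod_of_nonneg (fun t _ => (Real.exp_pos _).le), ← Real.exp_sum]
    exact ENNReal.ofReal_le_ofReal (Real.exp_le_exp.mpr hω.le)
  refine (measure_mono hsub).trans ((meas_ge_le_lintegral_div ?_ ?_ ?_).trans ?_)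
  · exact (measurable_prod_range (ℱ := fun _ => ‹MeasurableSpace Ω›) monotone_const
      (fun t => ENNReal.measurable_ofReal.comp (hfm (hX t) (hX (t + 1)))) T).aemeasurable
  · simpa using Real.exp_pos _
  · exact ENNReal.ofReal_ne_top
  · refine (ENNReal.div_le_div_right h _).trans ?_
    rw [← ENNReal.ofReal_ofNat, ← ENNReal.ofReal_pow zero_le_two,
      ← ENNReal.ofReal_div_of_pos (Real.exp_pos _)]
    apply ENNReal.ofReal_le_ofReal
    rw [div_le_iff₀ (Real.exp_pos _), ← Real.exp_add]
    have h2 : (2 : ℝ) ≤ Real.exp 1 := by linarith [Real.add_one_le_exp 1]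
    refine (pow_le_pow_left₀ zero_le_two h2 T).trans_eq ?_
    rw [← Real.exp_nat_mul]
    ring_nf

end Jumps

/-- there is a universal constant `C` such that for all `η ∈ (0,1]`,
`b > 1`, `ε ∈ (0,1)` there is `c > 0` such that for every `(0,1]`-valued martingale
with `X_0 ∈ (0,1)` and `ℙ[X_{t+1} < X_t^b | X_0,…,X_t] ≥ η` a.s., and every `T ≥ 1`,
`ℙ[log X_T > (log X_0 + C·T)·b^{(1-ε)·η·T}] < exp(-c·ε·η·T)`. -/
theorem stmt1 :
    ∃ C : ℝ, ∀ η b ε : ℝ, 0 < η → η ≤ 1 → 1 < b → 0 < ε → ε < 1 →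
    ∃ c : ℝ, 0 < c ∧
    ∀ (Ω : Type) [MeasurableSpace Ω] (μ : Measure Ω) [IsProbabilityMeasure μ]
      (X : ℕ → Ω → ℝ),
      (∀ t, Measurable (X t)) →
      (∀ t, ∀ᵐ ω ∂μ, X t ω ∈ Set.Ioc (0 : ℝ) 1) →
      (∀ᵐ ω ∂μ, X 0 ω ∈ Set.Ioo (0 : ℝ) 1) →
      (∀ t, μ[X (t + 1) | pastSigma X t] =ᵐ[μ] X t) →
      (∀ t, ∀ᵐ ω ∂μ,
        η ≤ (μ[Set.indicator {ω' | X (t + 1) ω' < X t ω' ^ b}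
              (fun _ => (1 : ℝ)) | pastSigma X t]) ω) →
      ∀ T : ℕ, 1 ≤ T →
        (μ {ω | (Real.log (X 0 ω) + C * (T : ℝ)) * b ^ ((1 - ε) * η * (T : ℝ))
                < Real.log (X T ω)}).toReal
          < Real.exp (-(c * ε * η * (T : ℝ))) := by
  classical
  refine ⟨2, fun η b ε hη hη1 hb hε hε1 => ?_⟩
  obtain ⟨c, hc, hrate⟩ := exists_exp_rate hη hη1 hε hε1
  refine ⟨c, hc, fun Ω _ μ _ X hX hmem _ hmart hjump T hT => ?_⟩
  have hmem' : ∀ᵐ ω ∂μ, ∀ t, X t ω ∈ Set.Ioc (0 : ℝ) 1 := ae_all_iff.mpr hmem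
  have hT0 : (1 : ℝ) ≤ T := by exact_mod_cast hT
  set B := {ω | (Real.log (X 0 ω) + 2 * (T : ℝ)) * b ^ ((1 - ε) * η * (T : ℝ))
    < Real.log (X T ω)}
  refine hrate T _ hT ?_ ?_
  · have hmeas : MeasurableSet (⋂ t ∈ Finset.range T, jumpSet X b t) :=
      Finset.measurableSet_biInter _ fun t _ => measurableSet_jumpSet (hX t) (hX (t + 1))
    have hsub : B ≤ᵐ[μ] (⋂ t ∈ Finset.range T, jumpSet X b t)ᶜ := by
      filter_upwards [hmem'] with ω hω hB hall
      have hall' : ∀ t ∈ Finset.range T, X (t + 1) ω < X t ω ^ b :=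
        fun t ht => Set.mem_iInter₂.mp hall t ht
      refine absurd hB (not_lt.mpr (log_le_of_jumps hω hb (T := T) ?_ ?_))
      · rw [Finset.filter_true_of_mem hall', Finset.card_range]
        nlinarith [mul_pos hε hη]
      · refine (Finset.sum_nonpos fun t ht => max_le ?_ le_rfl).trans (by positivity)
        rw [sub_nonpos]
        refine Real.log_le_log (hω _).1 ((hall' t ht).le.trans ?_)
        exact (Real.rpow_le_rpow_of_exponent_ge (hω t).1 (hω t).2 hb.le).trans_eq
          (Real.rpow_one _)
    have h1 : η ^ T ≤ μ.real (⋂ t ∈ Finset.range T, jumpSet X b t) := by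
      have := pow_le_measure_jumps hη hX hjump T
      rw [← ENNReal.ofReal_pow hη.le] at this
      exact (ENNReal.ofReal_le_iff_le_toReal (measure_ne_top _ _)).mp this
    have h2 : (μ B).toReal ≤ μ.real (⋂ t ∈ Finset.range T, jumpSet X b t)ᶜ :=
      ENNReal.toReal_mono (measure_ne_top _ _) (measure_mono_ae hsub)
    rw [probReal_compl_eq_one_sub hmeas] at h2
    linarith
  · have hsub : B ≤ᵐ[μ] ({ω | (((Finset.range T).filter fun t => ω ∈ jumpSet X b t).card : ℝ) <
        (1 - ε) * η * T} ∪ {ω | 2 * (T : ℝ) < ∑ t ∈ Finset.range T,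
          max (Real.log (X (t + 1) ω) - Real.log (X t ω)) 0} : Set Ω) := by
      filter_upwards [hmem'] with ω hω hB
      by_contra hcon
      obtain ⟨h1, h2⟩ := not_or.mp hcon
      exact absurd hB (not_lt.mpr (log_le_of_jumps hω hb (not_lt.mp h1) (not_lt.mp h2)))
    have hexp : Real.exp (-T) ≤ Real.exp (-(η * ε ^ 2 / 2) * T) := by
      rw [Real.exp_le_exp]
      have : η * ε ^ 2 ≤ 1 := mul_le_one₀ hη1 (by positivity) (by nlinarith)
      nlinarith
    refine ENNReal.toReal_le_of_le_ofReal (by positivity) ?_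
    refine (measure_mono_ae hsub).trans ((measure_union_le _ _).trans ?_)
    rw [two_mul (Real.exp _), ENNReal.ofReal_add (Real.exp_pos _).le (Real.exp_pos _).le]
    exact add_le_add (measure_card_jumps_lt_le hη hη1 hε hε1 hX hjump T)
      ((measure_sum_increments_gt_le hX hmem hmart T).trans (ENNReal.ofReal_le_ofReal hexp))
end

section
/- For every prime q, every mixing matrix M ∈ 𝔽_q^{k×k}, and every ε > 0, the Kronecker square M⊗M ∈ 𝔽_q^{k²×k²} satisfies (1/k², 2-ε)-exponential polarization. -/
open scoped BigOperators

/- Probability of an event under a probability mass function on a finite type. -/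
open Classical in
noncomputable def pmfProb {Ω : Type} [Fintype Ω] (μ : Ω → ℝ) (S : Set Ω) : ℝ :=
  ∑ ω : Ω, if ω ∈ S then μ ω else 0

/- Conditional Shannon entropy (base 2) `H(X|Y)` of finitely-valued random variables
on a finite probability space given by the mass function `μ`. -/
open Classical in
noncomputable def condEnt {Ω S T : Type} [Fintype Ω] [Fintype S] [Fintype T]
    (μ : Ω → ℝ) (X : Ω → S) (Y : Ω → T) : ℝ :=
  ∑ s : S, ∑ t : T,
    (if pmfProb μ {ω | X ω = s ∧ Y ω = t} = 0 then 0
     else -(pmfProb μ {ω | X ω = s ∧ Y ω = t}) *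
        Real.logb 2 (pmfProb μ {ω | X ω = s ∧ Y ω = t} / pmfProb μ {ω | Y ω = t}))

/- Normalized conditional entropy `H̄(X|Y) = H(X|Y)/log₂ q` for `X` valued in `𝔽_q`. -/
noncomputable def nCondEnt (q : ℕ) [NeZero q] {Ω T : Type} [Fintype Ω] [Fintype T]
    (μ : Ω → ℝ) (X : Ω → ZMod q) (Y : Ω → T) : ℝ :=
  condEnt μ X Y / Real.logb 2 q

/- A matrix `M ∈ 𝔽_q^{k×k}` satisfies `(η, b)`-exponential polarization. -/
open Classical in
noncomputable def ExpPolar (q : ℕ) [NeZero q] (k : ℕ)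
    (M : Matrix (Fin k) (Fin k) (ZMod q)) (η b : ℝ) : Prop :=
  ∃ τ : ℝ, 0 < τ ∧ ∀ δ : ℝ, 0 ≤ δ → δ < τ →
    ∀ (Ω Alph : Type) [Fintype Ω] [Fintype Alph] (μ : Ω → ℝ),
      (∀ ω, 0 ≤ μ ω) → (∑ ω : Ω, μ ω = 1) →
      ∀ (U : Fin k → Ω → ZMod q) (A : Fin k → Ω → Alph),
      -- the pairs (U_i, A_i) are i.i.d. with common marginal p
      (∃ p : ZMod q × Alph → ℝ,
        (∀ (i : Fin k) (u : ZMod q) (a : Alph),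
            pmfProb μ {ω | U i ω = u ∧ A i ω = a} = p (u, a)) ∧
        (∀ (u : Fin k → ZMod q) (a : Fin k → Alph),
            pmfProb μ {ω | ∀ i, U i ω = u i ∧ A i ω = a i} = ∏ i, p (u i, a i))) →
      (∀ i : Fin k, nCondEnt q μ (U i) (A i) ≤ δ) →
      η * k ≤ ((Finset.univ : Finset (Fin k)).filter (fun j : Fin k =>
        nCondEnt q μ (fun ω => Matrix.vecMul (fun i => U i ω) M j)
          (fun ω => ((fun i : Fin (j : ℕ) =>
              Matrix.vecMul (fun i' => U i' ω) M (Fin.castLE j.isLt.le i)),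
            (fun i => A i ω))) ≤ δ ^ b)).card

/- A matrix is mixing if it is invertible and no row permutation of it is upper triangular. -/
def IsMixing {q k : ℕ} (M : Matrix (Fin k) (Fin k) (ZMod q)) : Prop :=
  IsUnit M.det ∧ ∀ σ : Equiv.Perm (Fin k), ¬ (∀ i j : Fin k, j < i → M (σ i) j = 0)

/- The Kronecker square `M ⊗ M`, with the standard (lexicographic) indexing by `Fin (k*k)`. -/
noncomputable def kron2 {q k : ℕ} (M : Matrix (Fin k) (Fin k) (ZMod q)) :
    Matrix (Fin (k * k)) (Fin (k * k)) (ZMod q) :=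
  Matrix.reindex finProdFinEquiv finProdFinEquiv (Matrix.kroneckerMap (· * ·) M M)

lemma pmfProb_nonneg {Ω : Type} [Fintype Ω] {μ : Ω → ℝ} (hμ : ∀ ω, 0 ≤ μ ω) (S : Set Ω) :
    0 ≤ pmfProb μ S :=
  Finset.sum_nonneg fun ω _ => by split_ifs <;> simp [hμ]

lemma pmfProb_univ {Ω : Type} [Fintype Ω] (μ : Ω → ℝ) : pmfProb μ Set.univ = ∑ ω, μ ω := by
  simp [pmfProb]

/-- The law of total probability along the fibres of a random variable. -/
lemma pmfProb_preimage {Ω T : Type} [Fintype Ω] [Fintype T] (μ : Ω → ℝ) (Y : Ω → T)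
    (P : T → Ω → Prop) :
    pmfProb μ {ω | P (Y ω) ω} = ∑ t, pmfProb μ {ω | P t ω ∧ Y ω = t} := by
  classical
  simp only [pmfProb, Set.mem_ofPred_eq]
  rw [Finset.sum_comm]
  refine Finset.sum_congr rfl fun ω _ => ?_
  rw [Finset.sum_eq_single (Y ω)]
  · simp
  · intro t _ ht
    simp [ht.symm]
  · simp

lemma pmfProb_le_sum {Ω ι : Type} [Fintype Ω] {μ : Ω → ℝ} (hμ : ∀ ω, 0 ≤ μ ω) (s : Finset ι)
    (S : Set Ω) (B : ι → Set Ω) (h : ∀ ω ∈ S, ∃ i ∈ s, ω ∈ B i) :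
    pmfProb μ S ≤ ∑ i ∈ s, pmfProb μ (B i) := by
  classical
  simp only [pmfProb]
  rw [Finset.sum_comm]
  refine Finset.sum_le_sum fun ω _ => ?_
  have hnn : ∀ i ∈ s, (0 : ℝ) ≤ if ω ∈ B i then μ ω else 0 := fun i _ => by
    split_ifs <;> simp [hμ]
  split_ifs with hω
  · obtain ⟨i, hi, hiB⟩ := h ω hω
    calc μ ω = if ω ∈ B i then μ ω else 0 := by rw [if_pos hiB]
      _ ≤ _ := Finset.single_le_sum hnn hi
  · exact Finset.sum_nonneg hnn

lemma sum_joint_left {Ω S T : Type} [Fintype Ω] [Fintype S] (μ : Ω → ℝ)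
    (X : Ω → S) (Y : Ω → T) (t : T) :
    ∑ s, pmfProb μ {ω | X ω = s ∧ Y ω = t} = pmfProb μ {ω | Y ω = t} := by
  rw [pmfProb_preimage μ X fun _ ω => Y ω = t]
  simp only [and_comm]

lemma sum_marginal {Ω T : Type} [Fintype Ω] [Fintype T] (μ : Ω → ℝ) (Y : Ω → T) :
    ∑ t, pmfProb μ {ω | Y ω = t} = ∑ ω, μ ω := by
  rw [← pmfProb_univ μ]
  simpa using (pmfProb_preimage μ Y fun _ _ => True).symm

lemma joint_le_marginal {Ω S T : Type} [Fintype Ω] [Fintype S] {μ : Ω → ℝ}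
    (hμ : ∀ ω, 0 ≤ μ ω) (X : Ω → S) (Y : Ω → T) (s : S) (t : T) :
    pmfProb μ {ω | X ω = s ∧ Y ω = t} ≤ pmfProb μ {ω | Y ω = t} := by
  rw [← sum_joint_left μ X Y t]
  exact Finset.single_le_sum (f := fun s => pmfProb μ {ω | X ω = s ∧ Y ω = t})
    (fun s _ => pmfProb_nonneg hμ _) (Finset.mem_univ s)

/-- The error probability of a guess `f` of `X` from `Y`. -/
lemma pmfProb_ne_guess {Ω S T : Type} [Fintype Ω] [Fintype S] [Fintype T] (μ : Ω → ℝ)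
    (X : Ω → S) (Y : Ω → T) (f : T → S) :
    pmfProb μ {ω | X ω ≠ f (Y ω)} =
      ∑ t, (pmfProb μ {ω | Y ω = t} - pmfProb μ {ω | X ω = f t ∧ Y ω = t}) := by
  classical
  rw [pmfProb_preimage μ Y fun t ω => X ω ≠ f t]
  refine Finset.sum_congr rfl fun t _ => ?_
  rw [eq_sub_iff_add_eq]
  simp only [pmfProb, Set.mem_ofPred_eq]
  rw [← Finset.sum_add_distrib]
  refine Finset.sum_congr rfl fun ω _ => ?_
  by_cases h1 : Y ω = t <;> by_cases h2 : X ω = f t <;> simp [h1, h2]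

lemma condEnt_mul_log_two {Ω S T : Type} [Fintype Ω] [Fintype S] [Fintype T] (μ : Ω → ℝ)
    (X : Ω → S) (Y : Ω → T) :
    condEnt μ X Y * Real.log 2 = ∑ t, ∑ s, -(pmfProb μ {ω | X ω = s ∧ Y ω = t}) *
      Real.log (pmfProb μ {ω | X ω = s ∧ Y ω = t} / pmfProb μ {ω | Y ω = t}) := by
  rw [condEnt, Finset.sum_comm, Finset.sum_mul]
  refine Finset.sum_congr rfl fun t _ => ?_
  rw [Finset.sum_mul]
  refine Finset.sum_congr rfl fun s _ => ?_
  split_ifs with h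
  · simp [h]
  · have : Real.log 2 ≠ 0 := (Real.log_pos one_lt_two).ne'
    rw [Real.logb]
    field_simp

/-- Maximum-likelihood guessing errs with probability at most the conditional entropy. -/
lemma pmfProb_ne_guess_le_condEnt {Ω S T : Type} [Fintype Ω] [Fintype S] [Fintype T]
    {μ : Ω → ℝ} (hμ : ∀ ω, 0 ≤ μ ω) (X : Ω → S) (Y : Ω → T) (f : T → S)
    (hf : ∀ s t, pmfProb μ {ω | X ω = s ∧ Y ω = t} ≤ pmfProb μ {ω | X ω = f t ∧ Y ω = t}) :
    pmfProb μ {ω | X ω ≠ f (Y ω)} ≤ condEnt μ X Y * Real.log 2 := by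
  rw [pmfProb_ne_guess, condEnt_mul_log_two]
  refine Finset.sum_le_sum fun t _ => ?_
  set m := pmfProb μ {ω | Y ω = t} with hm
  set J : S → ℝ := fun s => pmfProb μ {ω | X ω = s ∧ Y ω = t} with hJ
  have hJ0 : ∀ s, 0 ≤ J s := fun s => pmfProb_nonneg hμ _
  have hJm : ∀ s, J s ≤ m := fun s => joint_le_marginal hμ X Y s t
  have hsum : ∑ s, J s = m := sum_joint_left μ X Y t
  have hm0 : 0 ≤ m := pmfProb_nonneg hμ _
  calc m - J (f t) = ∑ s, (J s - J s * (J (f t) / m)) := by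
        rw [Finset.sum_sub_distrib, ← Finset.sum_mul, hsum]
        rcases eq_or_ne m 0 with h | h
        · have := hJm (f t)
          have := hJ0 (f t)
          rw [h]
          simp
          linarith
        · field_simp
    _ ≤ ∑ s, -(J s) * Real.log (J s / m) := by
        refine Finset.sum_le_sum fun s _ => ?_
        rcases (hJ0 s).eq_or_lt with h | h
        · simp [← h]
        · have hmpos : 0 < m := h.trans_le (hJm s)
          have h1 := Real.log_le_sub_one_of_pos (div_pos h hmpos)
          have h2 : J s / m ≤ J (f t) / m := by gcongr; exact hf s t
          nlinarith

/-- A form of Fano's inequality (in nats) with a free parameter `θ`. -/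
lemma condEnt_le_of_guess {Ω S T : Type} [Fintype Ω] [Fintype S] [Fintype T]
    {μ : Ω → ℝ} (hμ : ∀ ω, 0 ≤ μ ω) (hμ1 : ∑ ω, μ ω = 1) (X : Ω → S) (Y : Ω → T) (f : T → S)
    {θ : ℝ} (hθ : 0 < θ) (hθ2 : θ ≤ 1 / 2) :
    condEnt μ X Y * Real.log 2 ≤
      2 * θ + pmfProb μ {ω | X ω ≠ f (Y ω)} * (Real.log (Fintype.card S) - Real.log θ) := by
  classical
  rw [pmfProb_ne_guess, condEnt_mul_log_two, Finset.sum_mul]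
  have h2θ : 2 * θ = ∑ t, pmfProb μ {ω | Y ω = t} * (2 * θ) := by
    rw [← Finset.sum_mul, sum_marginal, hμ1, one_mul]
  rw [h2θ, ← Finset.sum_add_distrib]
  refine Finset.sum_le_sum fun t _ => ?_
  set m := pmfProb μ {ω | Y ω = t} with hm
  set J : S → ℝ := fun s => pmfProb μ {ω | X ω = s ∧ Y ω = t} with hJ
  have hJ0 : ∀ s, 0 ≤ J s := fun s => pmfProb_nonneg hμ _
  have hJm : ∀ s, J s ≤ m := fun s => joint_le_marginal hμ X Y s t
  have hsum : ∑ s, J s = m := sum_joint_left μ X Y t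
  have hm0 : 0 ≤ m := pmfProb_nonneg hμ _
  have hc : (0 : ℝ) < Fintype.card S := by
    exact_mod_cast Fintype.card_pos_iff.2 ⟨f t⟩
  set c : ℝ := ((Fintype.card S : ℕ) : ℝ) with hcdef
  set Q : S → ℝ := fun s => if s = f t then 1 - θ else θ / c with hQ
  have hQ0 : ∀ s, 0 < Q s := fun s => by
    simp only [hQ]
    split_ifs
    · linarith
    · positivity
  have hQsum : ∑ s, Q s ≤ 1 := by
    calc ∑ s, Q s ≤ ∑ s, ((if s = f t then 1 - θ else 0) + θ / c) := by
          refine Finset.sum_le_sum fun s _ => ?_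
          simp only [hQ]
          split_ifs
          · have : 0 < θ / c := by positivity
            linarith
          · simp
      _ = 1 := by
          rw [Finset.sum_add_distrib]
          simp [← hcdef]
          field_simp
          ring
  have gibbs : ∑ s, -(J s) * Real.log (J s / m) ≤ ∑ s, -(J s) * Real.log (Q s) := by
    have key : ∀ s, -(J s) * Real.log (J s / m) ≤ -(J s) * Real.log (Q s) + (Q s * m - J s) := by
      intro s
      rcases (hJ0 s).eq_or_lt with h | h
      · simp only [← h]
        have := mul_nonneg (hQ0 s).le hm0
        simpa using this
      · have hmpos : 0 < m := h.trans_le (hJm s)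
        have h1 := Real.log_le_sub_one_of_pos (div_pos (mul_pos (hQ0 s) hmpos) h)
        rw [Real.log_div (mul_pos (hQ0 s) hmpos).ne' h.ne',
          Real.log_mul (hQ0 s).ne' hmpos.ne'] at h1
        rw [Real.log_div h.ne' hmpos.ne']
        have h3 := mul_le_mul_of_nonneg_left h1 h.le
        have h4 : J s * (Q s * m / J s - 1) = Q s * m - J s := by field_simp
        nlinarith
    calc _ ≤ ∑ s, (-(J s) * Real.log (Q s) + (Q s * m - J s)) :=
          Finset.sum_le_sum fun s _ => key s
      _ ≤ _ := by
          rw [Finset.sum_add_distrib, Finset.sum_sub_distrib, ← Finset.sum_mul, hsum]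
          nlinarith
  refine gibbs.trans ?_
  have hlog : -Real.log (1 - θ) ≤ 2 * θ := by
    have h1 := Real.one_sub_inv_le_log_of_pos (show 0 < 1 - θ by linarith)
    have h2 : (1 - θ)⁻¹ ≤ 1 + 2 * θ := by
      rw [inv_le_iff_one_le_mul₀ (by linarith)]
      nlinarith
    linarith
  have hrest : ∑ s ∈ Finset.univ.erase (f t), J s = m - J (f t) := by
    rw [← hsum, ← Finset.add_sum_erase _ _ (Finset.mem_univ (f t))]
    ring
  rw [← Finset.add_sum_erase _ _ (Finset.mem_univ (f t))]
  have h1 : ∑ s ∈ Finset.univ.erase (f t), -(J s) * Real.log (Q s) =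
      (m - J (f t)) * (Real.log c - Real.log θ) := by
    rw [← hrest, Finset.sum_mul]
    refine Finset.sum_congr rfl fun s hs => ?_
    have : s ≠ f t := (Finset.mem_erase.1 hs).1
    simp only [hQ, if_neg this]
    rw [Real.log_div hθ.ne' hc.ne']
    ring
  rw [h1]
  have h2 : -(J (f t)) * Real.log (Q (f t)) ≤ m * (2 * θ) := by
    simp only [hQ, if_true]
    have := hJ0 (f t)
    have := hJm (f t)
    nlinarith
  exact add_le_add h2 le_rfl

/-- Coordinates of an i.i.d. family are pairwise independent. -/
lemma pmfProb_pair_of_iid {Ω S ι : Type} [Fintype Ω] [Fintype S] [Fintype ι] {μ : Ω → ℝ}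
    (hμ1 : ∑ ω, μ ω = 1) (Z : ι → Ω → S) (p : S → ℝ)
    (hmarg : ∀ i z, pmfProb μ {ω | Z i ω = z} = p z)
    (hprod : ∀ z : ι → S, pmfProb μ {ω | ∀ i, Z i ω = z i} = ∏ i, p (z i))
    {i i' : ι} (hne : i ≠ i') (B : Set S) :
    pmfProb μ {ω | Z i ω ∈ B ∧ Z i' ω ∈ B} =
      pmfProb μ {ω | Z i ω ∈ B} * pmfProb μ {ω | Z i' ω ∈ B} := by
  classical
  have hp1 : ∑ s, p s = 1 := by
    rw [← hμ1, ← sum_marginal μ (Z i)]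
    exact Finset.sum_congr rfl fun s _ => (hmarg i s).symm
  set β : ℝ := ∑ s, if s ∈ B then p s else 0 with hβ
  have hsingle : ∀ l, pmfProb μ {ω | Z l ω ∈ B} = β := by
    intro l
    rw [pmfProb_preimage μ (Z l) fun s _ => s ∈ B, hβ]
    refine Finset.sum_congr rfl fun s _ => ?_
    by_cases hs : s ∈ B
    · simp [hs, hmarg]
    · simp [hs, pmfProb]
  rw [hsingle, hsingle]
  have hfib := pmfProb_preimage μ (fun ω l => Z l ω) fun z _ => z i ∈ B ∧ z i' ∈ B
  rw [hfib]
  set w : ι → S → ℝ := fun l s => if (l = i ∨ l = i') ∧ s ∉ B then 0 else p s with hw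
  calc _ = ∑ z : ι → S, ∏ l, w l (z l) := by
        refine Finset.sum_congr rfl fun z _ => ?_
        by_cases hz : z i ∈ B ∧ z i' ∈ B
        · simp only [hz, true_and, and_self]
          have : {ω | (fun l => Z l ω) = z} = {ω | ∀ l, Z l ω = z l} := by
            ext ω
            simp [funext_iff]
          rw [this, hprod]
          refine Finset.prod_congr rfl fun l _ => ?_
          have : ¬ ((l = i ∨ l = i') ∧ z l ∉ B) := by
            rintro ⟨rfl | rfl, h⟩
            · exact h hz.1
            · exact h hz.2
          simp only [hw, if_neg this]
        · have h0 : pmfProb μ {ω | (z i ∈ B ∧ z i' ∈ B) ∧ (fun l => Z l ω) = z} = 0 := by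
            simp [pmfProb, hz]
          rw [h0]
          symm
          rcases not_and_or.1 hz with h | h
          · exact Finset.prod_eq_zero (Finset.mem_univ i) (by simp [hw, h])
          · exact Finset.prod_eq_zero (Finset.mem_univ i') (by simp [hw, h])
    _ = ∏ l, ∑ s, w l s := by
        rw [Finset.prod_univ_sum, Fintype.piFinset_univ]
    _ = ∏ l, if l ∈ ({i, i'} : Finset ι) then β else 1 := by
        refine Finset.prod_congr rfl fun l _ => ?_
        by_cases hl : l = i ∨ l = i'
        · simp only [hw, hl, true_and, Finset.mem_insert, Finset.mem_singleton, if_true, hβ]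
          refine Finset.sum_congr rfl fun s _ => ?_
          by_cases hs : s ∈ B <;> simp [hs]
        · simp only [hw, hl, false_and, Finset.mem_insert, Finset.mem_singleton, if_false, hp1]
    _ = β * β := by
        rw [Finset.prod_ite_mem, Finset.univ_inter, Finset.prod_pair hne]

/-- A mixing matrix has a column index of partial distance at least two. -/
lemma IsMixing.exists_partial_distance {q k : ℕ} {M : Matrix (Fin k) (Fin k) (ZMod q)}
    (hM : IsMixing M) (hq : q.Prime) :
    ∃ j : Fin k, ∀ x : Fin k → ZMod q, (∀ i < j, Matrix.vecMul x M i = 0) →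
      Matrix.vecMul x M j ≠ 0 → ∃ a b, a ≠ b ∧ x a ≠ 0 ∧ x b ≠ 0 := by
  have := Fact.mk hq
  by_contra! hcon
  have hrow : ∀ j : Fin k, ∃ r : Fin k, (∀ i < j, M r i = 0) ∧ M r j ≠ 0 := by
    intro j
    obtain ⟨x, hx0, hxj, hx⟩ := hcon j
    obtain ⟨r, hr⟩ : ∃ r, x r * M r j ≠ 0 := by
      by_contra! h
      exact hxj (by
        simp only [Matrix.vecMul, dotProduct, h, Finset.sum_const_zero])
    have hxr : x r ≠ 0 := left_ne_zero_of_mul hr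
    have hsupp : ∀ b, b ≠ r → x b = 0 := fun b hb => hx r b hb.symm hxr
    have hval : ∀ i, Matrix.vecMul x M i = x r * M r i := fun i => by
      rw [Matrix.vecMul, dotProduct]
      exact Finset.sum_eq_single r (fun b _ hb => by rw [hsupp b hb, zero_mul]) (by simp)
    refine ⟨r, fun i hi => ?_, right_ne_zero_of_mul hr⟩
    have h := hx0 i hi
    rw [hval] at h
    exact (mul_eq_zero.1 h).resolve_left hxr
  choose r hr0 hr using hrow
  have hinj : Function.Injective r := by
    intro j j' h
    rcases lt_trichotomy j j' with hlt | heq | hlt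
    · exact absurd (h ▸ hr0 j' j hlt) (hr j)
    · exact heq
    · exact absurd (h ▸ hr0 j j' hlt) (hr j')
  exact hM.2 (Equiv.ofBijective r (Finite.injective_iff_bijective.1 hinj))
    fun i j hij => hr0 i j hij

lemma vecMul_kron2 {q k : ℕ} (M : Matrix (Fin k) (Fin k) (ZMod q))
    (x : Fin (k * k) → ZMod q) (a b : Fin k) :
    Matrix.vecMul x (kron2 M) (finProdFinEquiv (a, b)) =
      Matrix.vecMul (fun c => Matrix.vecMul (fun r => x (finProdFinEquiv (r, c))) M a) M b := by
  simp only [Matrix.vecMul, dotProduct, kron2, Matrix.reindex_apply, Matrix.submatrix_apply,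
    Equiv.symm_apply_apply]
  rw [← Equiv.sum_comp finProdFinEquiv, Fintype.sum_prod_type, Finset.sum_comm]
  refine Finset.sum_congr rfl fun c _ => ?_
  rw [Finset.sum_mul]
  refine Finset.sum_congr rfl fun r _ => ?_
  simp [Matrix.kroneckerMap_apply, mul_assoc]

/-- The Kronecker square of a mixing matrix has a column index of partial distance at least
three. -/
lemma IsMixing.exists_kron2_partial_distance {q k : ℕ}
    {M : Matrix (Fin k) (Fin k) (ZMod q)} (hM : IsMixing M) (hq : q.Prime) :
    ∃ j : Fin (k * k), ∀ x : Fin (k * k) → ZMod q,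
      (∀ i < j, Matrix.vecMul x (kron2 M) i = 0) → Matrix.vecMul x (kron2 M) j ≠ 0 →
        ¬ ∃ e e', ∀ c, c ≠ e → c ≠ e' → x c = 0 := by
  obtain ⟨j, hj⟩ := hM.exists_partial_distance hq
  refine ⟨finProdFinEquiv (j, j), fun x hx0 hxj => ?_⟩
  set W : Fin k → Fin k → ZMod q := fun a c =>
    Matrix.vecMul (fun r => x (finProdFinEquiv (r, c))) M a with hW
  have hlt : ∀ a b, (a < j ∨ a = j ∧ b < j) → Matrix.vecMul (W a) M b = 0 := by
    intro a b hab
    rw [hW, ← vecMul_kron2]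
    refine hx0 _ ?_
    rw [Fin.lt_def]
    simp only [finProdFinEquiv_apply_val]
    rcases hab with h | ⟨rfl, h⟩
    · have h1 : (a : ℕ) + 1 ≤ j := h
      have h2 := Nat.mul_le_mul_left k h1
      have := b.2
      rw [Nat.mul_add] at h2
      omega
    · have : (b : ℕ) < a := h
      omega
  have hWlt : ∀ a < j, ∀ c, W a c = 0 := by
    intro a ha
    have hz : Matrix.vecMul (W a) M = Matrix.vecMul 0 M := by
      rw [Matrix.zero_vecMul]
      exact funext fun b => hlt a b (Or.inl ha)
    have hinj := Matrix.vecMul_injective_of_isUnit ((Matrix.isUnit_iff_isUnit_det M).2 hM.1)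
    exact congrFun (hinj hz)
  obtain ⟨a, b, hab, ha, hb⟩ := hj (W j) (fun b hb => hlt j b (Or.inr ⟨rfl, hb⟩)) (by
    rwa [hW, ← vecMul_kron2])
  obtain ⟨r, r', hr, hr1, hr2⟩ := hj _ (fun i hi => hWlt i hi a) ha
  obtain ⟨s, -, -, hs1, -⟩ := hj _ (fun i hi => hWlt i hi b) hb
  rintro ⟨e, e', he⟩
  have hmem : ∀ c, x c ≠ 0 → c = e ∨ c = e' := fun c hc => by
    by_contra! h
    exact hc (he c h.1 h.2)
  have h1 := hmem _ hr1
  have h2 := hmem _ hr2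
  have h3 := hmem _ hs1
  have n12 : finProdFinEquiv (r, a) ≠ finProdFinEquiv (r', a) := by simp [hr]
  have n13 : finProdFinEquiv (r, a) ≠ finProdFinEquiv (s, b) := by simp [hab]
  have n23 : finProdFinEquiv (r', a) ≠ finProdFinEquiv (s, b) := by simp [hab]
  grind

/-- A column of partial distance at least three can be decoded from the previous ones and
from guesses for the inputs unless two of the guesses are wrong. -/
lemma exists_decoder {q K : ℕ} {Alph : Type} (N : Matrix (Fin K) (Fin K) (ZMod q))
    (j : Fin K) (hj : ∀ x : Fin K → ZMod q, (∀ i < j, Matrix.vecMul x N i = 0) →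
      Matrix.vecMul x N j ≠ 0 → ¬ ∃ e e', ∀ c, c ≠ e → c ≠ e' → x c = 0)
    (f : Alph → ZMod q) :
    ∃ g : (Fin (j : ℕ) → ZMod q) × (Fin K → Alph) → ZMod q,
      ∀ (u : Fin K → ZMod q) (a : Fin K → Alph),
        Matrix.vecMul u N j ≠
          g (fun i => Matrix.vecMul u N (Fin.castLE j.isLt.le i), a) →
        ∃ i i', i ≠ i' ∧ u i ≠ f (a i) ∧ u i' ≠ f (a i') := by
  classical
  let good (y : (Fin (j : ℕ) → ZMod q) × (Fin K → Alph)) (u : Fin K → ZMod q) : Prop :=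
    (∀ i, Matrix.vecMul u N (Fin.castLE j.isLt.le i) = y.1 i) ∧
      ∃ e, ∀ c, c ≠ e → u c = f (y.2 c)
  refine ⟨fun y => if h : ∃ u, good y u then Matrix.vecMul h.choose N j else 0, ?_⟩
  intro u a hne
  by_contra! hcon
  have hu : good (fun i => Matrix.vecMul u N (Fin.castLE j.isLt.le i), a) u := by
    refine ⟨fun i => rfl, ?_⟩
    by_cases h : ∃ e, u e ≠ f (a e)
    · obtain ⟨e, he⟩ := h
      exact ⟨e, fun c hc => hcon e c hc.symm he⟩
    · push Not at h
      exact ⟨j, fun c _ => h c⟩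
  have hex : ∃ v, good (fun i => Matrix.vecMul u N (Fin.castLE j.isLt.le i), a) v := ⟨u, hu⟩
  beta_reduce at hne
  rw [dif_pos hex] at hne
  obtain ⟨hv, e', he'⟩ := hex.choose_spec
  obtain ⟨-, e, he⟩ := hu
  refine hj (u - hex.choose) ?_ ?_ ⟨e, e', fun c h1 h2 => ?_⟩
  · intro i hi
    rw [Matrix.sub_vecMul, Pi.sub_apply, sub_eq_zero]
    exact (hv ⟨i, hi⟩).symm
  · rw [Matrix.sub_vecMul, Pi.sub_apply]
    exact sub_ne_zero.2 hne
  · rw [Pi.sub_apply, he c h1, he' c h2, sub_self]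

open Filter Topology in
lemma exists_threshold (C L ε : ℝ) (hL : 0 < L) (hε : 0 < ε) :
    ∃ τ : ℝ, 0 < τ ∧ ∀ δ : ℝ, 0 < δ → δ < τ →
      2 * δ ^ 2 + C * δ ^ 2 * (L - Real.log (δ ^ 2)) ≤ δ ^ (2 - ε) * L := by
  have h1 : Tendsto (fun δ : ℝ => δ ^ ε) (𝓝[>] 0) (𝓝 0) := by
    have := (Real.continuousAt_rpow_const 0 ε (Or.inr hε.le)).tendsto
    rw [Real.zero_rpow hε.ne'] at this
    exact this.mono_left nhdsWithin_le_nhds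
  have h2 := tendsto_log_mul_rpow_nhdsGT_zero hε
  have h3 : Tendsto (fun δ : ℝ => (2 + C * L) * δ ^ ε - 2 * C * (Real.log δ * δ ^ ε))
      (𝓝[>] 0) (𝓝 0) := by
    simpa using (h1.const_mul (2 + C * L)).sub (h2.const_mul (2 * C))
  obtain ⟨τ, hτ, h⟩ := mem_nhdsGT_iff_exists_Ioo_subset.1 (h3.eventually (gt_mem_nhds hL))
  refine ⟨τ, hτ, fun δ hδ hδτ => ?_⟩
  have hlt : (2 + C * L) * δ ^ ε - 2 * C * (Real.log δ * δ ^ ε) < L := h ⟨hδ, hδτ⟩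
  have hpow : δ ^ 2 = δ ^ (2 - ε) * δ ^ ε := by
    rw [← Real.rpow_add hδ, sub_add_cancel, Real.rpow_two]
  rw [Real.log_pow]
  have hpos : 0 < δ ^ (2 - ε) := Real.rpow_pos_of_pos hδ _
  have := mul_le_mul_of_nonneg_left hlt.le hpos.le
  calc _ = δ ^ 2 * ((2 + C * L) - 2 * C * Real.log δ) := by push_cast; ring
    _ = δ ^ (2 - ε) * ((2 + C * L) * δ ^ ε - 2 * C * (Real.log δ * δ ^ ε)) := by
        rw [hpow]; ring
    _ ≤ _ := this

lemma nCondEnt_eq (q : ℕ) [NeZero q] {Ω T : Type} [Fintype Ω] [Fintype T]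
    (μ : Ω → ℝ) (X : Ω → ZMod q) (Y : Ω → T) :
    nCondEnt q μ X Y = condEnt μ X Y * Real.log 2 / Real.log q := by
  rw [nCondEnt, Real.logb, div_div_eq_mul_div]

/-- If the inputs have conditional entropy at most `δ`, a column of partial distance at least
three can be guessed with error probability of order `δ ^ 2`. -/
lemma exists_guess_pmfProb_le {q K : ℕ} [NeZero q] (hq : q.Prime)
    (N : Matrix (Fin K) (Fin K) (ZMod q)) (j : Fin K)
    (hj : ∀ x : Fin K → ZMod q, (∀ i < j, Matrix.vecMul x N i = 0) →
      Matrix.vecMul x N j ≠ 0 → ¬ ∃ e e', ∀ c, c ≠ e → c ≠ e' → x c = 0)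
    {Ω Alph : Type} [Fintype Ω] [Fintype Alph] {μ : Ω → ℝ} (hμ : ∀ ω, 0 ≤ μ ω)
    (hμ1 : ∑ ω, μ ω = 1) (U : Fin K → Ω → ZMod q) (A : Fin K → Ω → Alph)
    (p : ZMod q × Alph → ℝ)
    (hmarg : ∀ (i : Fin K) (u : ZMod q) (a : Alph),
      pmfProb μ {ω | U i ω = u ∧ A i ω = a} = p (u, a))
    (hprod : ∀ (u : Fin K → ZMod q) (a : Fin K → Alph),
      pmfProb μ {ω | ∀ i, U i ω = u i ∧ A i ω = a i} = ∏ i, p (u i, a i))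
    {δ : ℝ} (hδ : ∀ i, nCondEnt q μ (U i) (A i) ≤ δ) :
    ∃ g : (Fin (j : ℕ) → ZMod q) × (Fin K → Alph) → ZMod q,
      pmfProb μ {ω | Matrix.vecMul (fun i => U i ω) N j ≠
        g (fun i => Matrix.vecMul (fun i' => U i' ω) N (Fin.castLE j.isLt.le i),
          fun i => A i ω)} ≤ (K : ℝ) ^ 2 * Real.log q ^ 2 * δ ^ 2 := by
  classical
  have hlogq : 0 < Real.log q := Real.log_pos (by exact_mod_cast hq.one_lt)
  choose f hf using fun a : Alph => Finite.exists_max fun u : ZMod q => p (u, a)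
  obtain ⟨g, hg⟩ := exists_decoder N j hj f
  refine ⟨g, ?_⟩
  have herr : ∀ i, pmfProb μ {ω | U i ω ≠ f (A i ω)} ≤ Real.log q * δ := by
    intro i
    have h1 := pmfProb_ne_guess_le_condEnt hμ (U i) (A i) f fun s t => by
      rw [hmarg, hmarg]
      exact hf t s
    have h2 := hδ i
    rw [nCondEnt_eq, div_le_iff₀ hlogq] at h2
    linarith
  have hpair : ∀ i i', i ≠ i' →
      pmfProb μ {ω | U i ω ≠ f (A i ω) ∧ U i' ω ≠ f (A i' ω)} ≤ (Real.log q * δ) ^ 2 := by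
    intro i i' hne
    have h := pmfProb_pair_of_iid hμ1 (fun i ω => (U i ω, A i ω)) p
      (fun i z => by simpa [Prod.ext_iff] using hmarg i z.1 z.2)
      (fun z => by simpa [Prod.ext_iff] using hprod (fun i => (z i).1) fun i => (z i).2)
      hne {z | z.1 ≠ f z.2}
    simp only [Set.mem_ofPred_eq] at h
    rw [h, sq]
    exact mul_le_mul (herr i) (herr i') (pmfProb_nonneg hμ _)
      ((pmfProb_nonneg hμ _).trans (herr i))
  refine (pmfProb_le_sum hμ (Finset.univ : Finset (Fin K)).offDiag _
    (fun i => {ω | U i.1 ω ≠ f (A i.1 ω) ∧ U i.2 ω ≠ f (A i.2 ω)}) ?_).trans ?_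
  · intro ω hω
    obtain ⟨i, i', hne, h⟩ := hg _ _ hω
    exact ⟨(i, i'), by simpa using hne, h⟩
  · calc _ ≤ ∑ i ∈ (Finset.univ : Finset (Fin K)).offDiag, (Real.log q * δ) ^ 2 :=
          Finset.sum_le_sum fun i hi => hpair _ _ (Finset.mem_offDiag.1 hi).2.2
      _ = ((Finset.univ : Finset (Fin K)).offDiag.card : ℝ) * (Real.log q * δ) ^ 2 := by
          rw [Finset.sum_const, nsmul_eq_mul]
      _ ≤ (K : ℝ) ^ 2 * (Real.log q * δ) ^ 2 := by
          gcongr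
          rw [Finset.offDiag_card, Finset.card_univ, Fintype.card_fin, sq]
          exact_mod_cast Nat.sub_le _ _
      _ = _ := by ring

/-- For every prime `q`, every mixing matrix `M ∈ 𝔽_q^{k×k}` and every
`ε > 0`, the Kronecker square `M ⊗ M` satisfies `(1/k², 2-ε)`-exponential polarization. -/
theorem stmt4 (q : ℕ) [NeZero q] (hq : Nat.Prime q) {k : ℕ}
    (M : Matrix (Fin k) (Fin k) (ZMod q)) (hM : IsMixing M)
    (ε : ℝ) (hε : 0 < ε) :
    ExpPolar q (k * k) (kron2 M) (1 / (k : ℝ) ^ 2) (2 - ε) := by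
  obtain ⟨j, hj⟩ := hM.exists_kron2_partial_distance hq
  have hlogq : 0 < Real.log q := Real.log_pos (by exact_mod_cast hq.one_lt)
  set C : ℝ := ((k * k : ℕ) : ℝ) ^ 2 * Real.log q ^ 2 with hC
  obtain ⟨τ, hτ, hτ'⟩ := exists_threshold C (Real.log q) ε hlogq hε
  refine ⟨min τ (1 / 2), lt_min hτ one_half_pos, ?_⟩
  intro δ hδ0 hδτ Ω Alph _ _ μ hμ hμ1 U A ⟨p, hmarg, hprod⟩ hent
  obtain ⟨g, hg⟩ :=
    exists_guess_pmfProb_le hq (kron2 M) j hj hμ hμ1 U A p hmarg hprod hent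
  have hk : (k : ℝ) ≠ 0 := by
    rintro h
    have hk0 : k = 0 := by exact_mod_cast h
    subst hk0
    exact j.elim0
  have hone : 1 / (k : ℝ) ^ 2 * ((k * k : ℕ) : ℝ) = 1 := by
    push_cast
    field_simp
  rw [hone]
  norm_cast
  rw [Nat.one_le_iff_ne_zero, ← Nat.pos_iff_ne_zero, Finset.card_pos]
  refine ⟨j, Finset.mem_filter.2 ⟨Finset.mem_univ _, ?_⟩⟩
  have hfano : ∀ θ : ℝ, 0 < θ → θ ≤ 1 / 2 → _ := fun θ h0 h1 =>
    condEnt_le_of_guess hμ hμ1 (fun ω => Matrix.vecMul (fun i => U i ω) (kron2 M) j)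
      (fun ω => ((fun i : Fin (j : ℕ) =>
        Matrix.vecMul (fun i' => U i' ω) (kron2 M) (Fin.castLE j.isLt.le i)),
        (fun i => A i ω))) g h0 h1
  rw [ZMod.card] at hfano
  rw [nCondEnt_eq, div_le_iff₀ hlogq]
  rcases hδ0.eq_or_lt with rfl | hδ
  · have hρ := le_antisymm (hg.trans_eq (by simp)) (pmfProb_nonneg hμ _)
    simp only [hρ, zero_mul, add_zero] at hfano
    refine le_trans ?_ (mul_nonneg (Real.rpow_nonneg le_rfl _) hlogq.le)
    refine le_of_forall_pos_le_add fun θ hθ => ?_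
    have h := hfano (min (θ / 2) (1 / 2)) (by positivity) (min_le_right _ _)
    have := min_le_left (θ / 2) (1 / 2)
    linarith
  · have hδτ1 := hδτ.trans_le (min_le_left _ _)
    have hδ2 := hδτ.trans_le (min_le_right _ _)
    refine (hfano (δ ^ 2) (by positivity) (by nlinarith)).trans ((hτ' δ hδ hδτ1).trans' ?_)
    have hlog : Real.log (δ ^ 2) ≤ 0 := Real.log_nonpos (by positivity) (by nlinarith)
    gcongr
    linarith
end
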